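/- arXiv:2601.10262 — 2 statements merged into one kernel-verified Lean document; each statement's English description precedes it below -/
import Mathlib

section
/- For every subset A ⊆ {0,…,N−1}, the dual of the monomial code C_{G_N}(A) satisfies C_{G_N}(A)^⊥ = C_{G_N·Q_π·G_N}(Aᶜ), where Aᶜ = {0,…,N−1} ∖ A. -/
open Matrix

/-- The set of positions of nonzero bits (within `{0,…,m−1}`) of the binary expansion of `i`. -/
def bsupp (m i : ℕ) : Finset ℕ := (Finset.range m).filter fun k => i.testBit k

/-- The polar transform matrix `G_N`, `N = 2^m`: entry `(i,j)` is `1` iff `supp j ⊆ supp i`. -/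
def GN (m : ℕ) : Matrix (Fin (2^m)) (Fin (2^m)) (ZMod 2) :=
  fun i j => if bsupp m (j : ℕ) ⊆ bsupp m (i : ℕ) then 1 else 0

/-- The permutation matrix swapping `i` and `N−1−i`. -/
def Qpi (m : ℕ) : Matrix (Fin (2^m)) (Fin (2^m)) (ZMod 2) :=
  fun i j => if (j : ℕ) = 2^m - 1 - (i : ℕ) then 1 else 0

/-- The linear code spanned by the rows of `B` with index in `A`. -/
def code {N : ℕ} (B : Matrix (Fin N) (Fin N) (ZMod 2)) (A : Set (Fin N)) :
    Submodule (ZMod 2) (Fin N → ZMod 2) :=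
  Submodule.span (ZMod 2) ((fun i => B i) '' A)

/-- The dual code of a linear code `C ⊆ 𝔽₂^N`. -/
def dualCode {N : ℕ} (C : Submodule (ZMod 2) (Fin N → ZMod 2)) :
    Submodule (ZMod 2) (Fin N → ZMod 2) where
  carrier := {v | ∀ c ∈ C, ∑ k, v k * c k = 0}
  zero_mem' := by intro c hc; simp
  add_mem' := by
    intro a b ha hb c hc
    have h1 := ha c hc
    have h2 := hb c hc
    simp only [Pi.add_apply, add_mul, Finset.sum_add_distrib, h1, h2, add_zero]
  smul_mem' := by
    intro r v hv c hc
    have h := hv c hc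
    simp only [Pi.smul_apply, smul_eq_mul, mul_assoc, ← Finset.mul_sum, h, mul_zero]

lemma bsupp_subset_range (m i : ℕ) : bsupp m i ⊆ Finset.range m :=
  Finset.filter_subset _ _

lemma bsupp_injective (m : ℕ) : Function.Injective fun i : Fin (2 ^ m) => bsupp m i := by
  intro i j h
  refine Fin.ext (Nat.eq_of_testBit_eq fun k => ?_)
  by_cases hk : k < m
  · have := Finset.ext_iff.1 h k
    simp only [bsupp, Finset.mem_filter, Finset.mem_range, hk, true_and] at this
    exact Bool.eq_iff_iff.2 this
  · have hpow : 2 ^ m ≤ 2 ^ k := Nat.pow_le_pow_right two_pos (not_lt.1 hk)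
    rw [Nat.testBit_lt_two_pow (i.2.trans_le hpow), Nat.testBit_lt_two_pow (j.2.trans_le hpow)]

lemma image_bsupp (m : ℕ) :
    Finset.univ.image (fun i : Fin (2 ^ m) => bsupp m i) = (Finset.range m).powerset := by
  refine Finset.eq_of_subset_of_card_le ?_ ?_
  · intro S hS
    obtain ⟨i, -, rfl⟩ := Finset.mem_image.1 hS
    exact Finset.mem_powerset.2 (bsupp_subset_range m i)
  · simp [Finset.card_image_of_injective _ (bsupp_injective m)]

/-- Modulo two, the number of `k` with `S ⊆ supp k ⊆ T` is the indicator of `S = T`. -/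
lemma sum_indicator_bsupp_between (m : ℕ) {S T : Finset ℕ} (hT : T ⊆ Finset.range m) :
    (∑ k : Fin (2 ^ m), if S ⊆ bsupp m k ∧ bsupp m k ⊆ T then (1 : ZMod 2) else 0) =
      if S = T then 1 else 0 := by
  rw [← Finset.sum_image (s := Finset.univ) (g := fun k : Fin (2 ^ m) => bsupp m k)
    (f := fun U => if S ⊆ U ∧ U ⊆ T then (1 : ZMod 2) else 0) (bsupp_injective m).injOn,
    image_bsupp, Finset.sum_boole]
  have hIcc : (Finset.range m).powerset.filter (fun U => S ⊆ U ∧ U ⊆ T) = Finset.Icc S T := by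
    ext U
    simp only [Finset.mem_filter, Finset.mem_powerset, Finset.mem_Icc,
      and_iff_right_iff_imp]
    exact fun h => h.2.trans hT
  rw [hIcc]
  by_cases hST : S ⊆ T
  · rw [Finset.card_Icc_finset hST]
    split_ifs with h
    · simp [h]
    · have hlt := Finset.card_lt_card (hST.ssubset_of_ne h)
      rw [Nat.cast_pow, Nat.cast_ofNat, show (2 : ZMod 2) = 0 from rfl,
        zero_pow (Nat.sub_ne_zero_of_lt hlt)]
  · rw [Finset.Icc_eq_empty hST, if_neg fun h => hST h.subset]
    simp

lemma GN_mul_self (m : ℕ) : GN m * GN m = 1 := by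
  ext i j
  simp only [mul_apply, GN, one_apply, mul_ite, mul_one, mul_zero, ← ite_and]
  rw [sum_indicator_bsupp_between m (bsupp_subset_range m i)]
  exact if_congr ((bsupp_injective m).eq_iff.trans eq_comm) rfl rfl

lemma bsupp_two_pow_sub (m : ℕ) (i : Fin (2 ^ m)) :
    bsupp m (2 ^ m - 1 - i) = Finset.range m \ bsupp m i := by
  ext k
  rw [Nat.sub_sub, add_comm 1]
  simp only [bsupp, Finset.mem_filter, Finset.mem_range, Finset.mem_sdiff,
    Nat.testBit_two_pow_sub_succ i.2]
  by_cases hk : k < m <;> simp [hk]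

lemma Qpi_mul_GN_apply (m : ℕ) (i j : Fin (2 ^ m)) :
    (Qpi m * GN m) i j = if Disjoint (bsupp m i) (bsupp m j) then 1 else 0 := by
  have hlt : 2 ^ m - 1 - (i : ℕ) < 2 ^ m := by have := i.2; omega
  rw [mul_apply, Finset.sum_eq_single ⟨2 ^ m - 1 - i, hlt⟩]
  · simp only [Qpi, GN, if_true, one_mul, bsupp_two_pow_sub, Finset.subset_sdiff,
      bsupp_subset_range, true_and, disjoint_comm]
  · intro k _ hk
    rw [Qpi, if_neg fun h => hk (Fin.ext h), zero_mul]
  · simp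

lemma GN_mul_transpose (m : ℕ) : GN m * (GN m)ᵀ = Qpi m * GN m := by
  ext i j
  rw [Qpi_mul_GN_apply]
  have h := sum_indicator_bsupp_between m (S := ∅) (T := bsupp m i ∩ bsupp m j)
    (Finset.inter_subset_left.trans (bsupp_subset_range m i))
  simp only [Finset.empty_subset, true_and, Finset.subset_inter_iff] at h
  simp only [mul_apply, transpose_apply, GN, mul_ite, mul_one, mul_zero, ← ite_and]
  simp only [Finset.disjoint_iff_inter_eq_empty, eq_comm (b := (∅ : Finset ℕ)), ← h, and_comm]

lemma Qpi_mul_self (m : ℕ) : Qpi m * Qpi m = 1 := by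
  ext i j
  have hlt : 2 ^ m - 1 - (i : ℕ) < 2 ^ m := by have := i.2; omega
  rw [mul_apply, Finset.sum_eq_single ⟨2 ^ m - 1 - i, hlt⟩]
  · simp only [Qpi, if_true, one_mul, one_apply]
    refine if_congr ?_ rfl rfl
    rw [Fin.ext_iff]
    have := i.2
    omega
  · intro k _ hk
    rw [Qpi, if_neg fun h => hk (Fin.ext h), zero_mul]
  · simp

lemma GN_mul_Qpi_mul_GN_mul_transpose (m : ℕ) : GN m * Qpi m * GN m * (GN m)ᵀ = 1 := by
  rw [Matrix.mul_assoc, GN_mul_transpose, Matrix.mul_assoc, ← Matrix.mul_assoc (Qpi m),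
    Qpi_mul_self, Matrix.one_mul, GN_mul_self]

/-- If the rows of `B` and `G` are dual bases, the dual of the code spanned by some rows of `G`
is spanned by the complementary rows of `B`. -/
lemma dualCode_code_of_mul_transpose_eq_one {N : ℕ} {G B : Matrix (Fin N) (Fin N) (ZMod 2)}
    (h : B * Gᵀ = 1) (A : Set (Fin N)) : dualCode (code G A) = code B Aᶜ := by
  apply le_antisymm
  · intro v hv
    have hexp : v = ∑ i, (v ᵥ* Gᵀ) i • B i := by
      rw [← vecMul_eq_sum, vecMul_vecMul, mul_eq_one_comm.1 h, vecMul_one]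
    rw [hexp]
    refine Submodule.sum_mem _ fun i _ => ?_
    by_cases hi : i ∈ A
    · have hzero : (v ᵥ* Gᵀ) i = 0 := hv (G i) (Submodule.subset_span ⟨i, hi, rfl⟩)
      rw [hzero, zero_smul]
      exact Submodule.zero_mem _
    · exact Submodule.smul_mem _ _ (Submodule.subset_span ⟨i, hi, rfl⟩)
  · refine Submodule.span_le.2 ?_
    rintro _ ⟨i, hi, rfl⟩ c hc
    induction hc using Submodule.span_induction with
    | mem x hx =>
      obtain ⟨j, hj, rfl⟩ := hx
      have hij : i ≠ j := fun e => hi (e ▸ hj)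
      simpa [mul_apply, one_apply, hij] using congrFun (congrFun h i) j
    | zero => simp
    | add x y _ _ hx hy =>
      simp only [Pi.add_apply, mul_add, Finset.sum_add_distrib, hx, hy, add_zero]
    | smul a x _ hx =>
      simp only [Pi.smul_apply, smul_eq_mul, mul_left_comm _ a, ← Finset.mul_sum, hx, mul_zero]


/-- for every `A ⊆ {0,…,N−1}`, the dual of the monomial code `C_{G_N}(A)`
satisfies `C_{G_N}(A)^⊥ = C_{G_N·Q_π·G_N}(Aᶜ)`. -/
theorem stmt3 (m : ℕ) (hm : 0 < m) (A : Set (Fin (2^m))) :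
    dualCode (code (GN m) A) = code (GN m * Qpi m * GN m) Aᶜ := by
  exact dualCode_code_of_mul_transpose_eq_one (GN_mul_Qpi_mul_GN_mul_transpose m) A
end

section
/- Let P be an N×N upper triangular matrix over 𝔽₂ with all diagonal entries equal to 1 and let A ⊆ {0,…,N−1} be nonempty. Then C_{P·G_N}(A) ⊆ C_{G_N}({min(A),…,N−1}); in particular every upper polynomial polar code is contained in a monomial code of dimension N−min(A). -/
/-- Bit-support inclusion of `m`-bit numbers implies the numerical order. -/
lemma le_of_bsupp_subset {m i j : ℕ} (hj : j < 2 ^ m) (h : bsupp m j ⊆ bsupp m i) : j ≤ i := by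
  have hand : j &&& i = j := by
    refine Nat.eq_of_testBit_eq fun k => ?_
    rw [Nat.testBit_and]
    cases hk : j.testBit k with
    | false => simp
    | true =>
      have hkm : k < m := by
        by_contra hge
        have hlt : j < 2 ^ k := hj.trans_le (Nat.pow_le_pow_right two_pos (not_lt.mp hge))
        simp [Nat.testBit_lt_two_pow hlt] at hk
      have hki : k ∈ bsupp m i := h (by simp [bsupp, hkm, hk])
      simpa [bsupp, hkm] using hki
  exact hand ▸ Nat.and_le_right

/-- The polar transform matrix is lower unitriangular. -/
lemma det_GN (m : ℕ) : (GN m).det = 1 := by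
  rw [Matrix.det_of_isLowerTriangular]
  · simp [GN]
  · intro i j hij
    have hlt : i < j := hij
    exact if_neg fun h => (le_of_bsupp_subset j.isLt h).not_gt hlt

/-- A code spanned by rows of an invertible matrix has dimension the number of rows. -/
lemma finrank_code {N : ℕ} {B : Matrix (Fin N) (Fin N) (ZMod 2)} (hB : B.det ≠ 0)
    (A : Finset (Fin N)) : Module.finrank (ZMod 2) (code B A) = A.card := by
  have hli : LinearIndependent (ZMod 2) (fun i => B i) :=
    Matrix.linearIndependent_rows_of_det_ne_zero hB
  have hspan := finrank_span_eq_card (hli.comp ((↑) : A → Fin N) Subtype.val_injective)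
  rw [Set.range_comp, Subtype.range_coe_subtype, Fintype.card_coe] at hspan
  exact hspan

/-- Left multiplication by an upper triangular matrix maps rows into the span of later rows. -/
lemma code_mul_le {N : ℕ} {P : Matrix (Fin N) (Fin N) (ZMod 2)}
    (hP : ∀ i j : Fin N, j < i → P i j = 0) (B : Matrix (Fin N) (Fin N) (ZMod 2))
    {A : Set (Fin N)} {a : Fin N} (ha : ∀ i ∈ A, a ≤ i) :
    code (P * B) A ≤ code B {i | a ≤ i} := by
  refine Submodule.span_le.mpr ?_
  rintro _ ⟨i, hi, rfl⟩
  have hrow : (P * B) i = ∑ k, P i k • B k := by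
    ext j
    simp [Matrix.mul_apply]
  change (P * B) i ∈ code B {i | a ≤ i}
  rw [hrow]
  refine Submodule.sum_mem _ fun k _ => ?_
  rcases lt_or_ge k i with hk | hk
  · simp [hP i k hk]
  · exact Submodule.smul_mem _ _ (Submodule.subset_span ⟨k, (ha i hi).trans hk, rfl⟩)

/-- let `P` be upper triangular with unit diagonal over `𝔽₂` and let
`A ⊆ {0,…,N−1}` be nonempty.  Then `C_{P·G_N}(A) ⊆ C_{G_N}({min(A),…,N−1})`; in particular
every upper polynomial polar code is contained in a monomial code of dimension `N − min(A)`. -/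
theorem stmt13 (m : ℕ) (hm : 0 < m)
    (P : Matrix (Fin (2^m)) (Fin (2^m)) (ZMod 2))
    (hupper : ∀ i j : Fin (2^m), j < i → P i j = 0)
    (hdiag : ∀ i : Fin (2^m), P i i = 1)
    (A : Finset (Fin (2^m))) (hA : A.Nonempty) :
    code (P * GN m) ↑A ≤ code (GN m) {i : Fin (2^m) | A.min' hA ≤ i}
    ∧ Module.finrank (ZMod 2) (code (GN m) {i : Fin (2^m) | A.min' hA ≤ i})
        = 2^m - (A.min' hA : ℕ) := by
  refine ⟨code_mul_le hupper _ fun i hi => A.min'_le i hi, ?_⟩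
  have hset : {i : Fin (2^m) | A.min' hA ≤ i} = ↑(Finset.Ici (A.min' hA)) := by
    ext i
    simp
  rw [hset, finrank_code (by simp [det_GN]), Fin.card_Ici]
end
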